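/- arXiv:0902.3626 — 5 statements merged into one kernel-verified Lean document; each statement's English description precedes it below -/
import Mathlib

section
/- A category C equipped with a 2-cell structure (H, dom, cod, 0, +) is a 2-category if and only if the naturality condition cod(x)y + x·dom(y) = x·cod(y) + dom(x)y holds for every x ∈ H(B,C) and y ∈ H(A,B) and every triple of objects (A,B,C) of C; in that case the horizontal composition is given by x ∘ y = cod(x)y + x·dom(y) = x·cod(y) + dom(x)y, and the middle interchange law follows from the naturality condition. -/
open CategoryTheory

universe v u

/- elementary side (framework) -/
structure TwoCellData (C : Type u) [Category.{v} C] where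
  H : C → C → Type v
  dm : ∀ {A B : C}, H A B → (A ⟶ B)
  cd : ∀ {A B : C}, H A B → (A ⟶ B)
  zero : ∀ {A B : C}, (A ⟶ B) → H A B
  add : ∀ {A B : C} (x x' : H A B), dm x = cd x' → H A B
  actL : ∀ {A B B' : C}, (B ⟶ B') → H A B → H A B'
  actR : ∀ {A' A B : C}, H A B → (A' ⟶ A) → H A' B

namespace TwoCellData
variable {C : Type u} [Category.{v} C]
structure Lawful (S : TwoCellData C) : Prop where
  dm_actL : ∀ {A B B' : C} (g : B ⟶ B') (y : S.H A B), S.dm (S.actL g y) = S.dm y ≫ g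
  dm_actR : ∀ {A' A B : C} (x : S.H A B) (f : A' ⟶ A), S.dm (S.actR x f) = f ≫ S.dm x
  cd_actL : ∀ {A B B' : C} (g : B ⟶ B') (y : S.H A B), S.cd (S.actL g y) = S.cd y ≫ g
  cd_actR : ∀ {A' A B : C} (x : S.H A B) (f : A' ⟶ A), S.cd (S.actR x f) = f ≫ S.cd x
  actL_zero : ∀ {A B B' : C} (g : B ⟶ B') (f : A ⟶ B), S.actL g (S.zero f) = S.zero (f ≫ g)
  actR_zero : ∀ {A' A B : C} (f : A ⟶ B) (h : A' ⟶ A), S.actR (S.zero f) h = S.zero (h ≫ f)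
  actR_add : ∀ {A' A B : C} (x x' : S.H A B) (h : S.dm x = S.cd x') (f : A' ⟶ A)
      (h2 : S.dm (S.actR x f) = S.cd (S.actR x' f)),
      S.actR (S.add x x' h) f = S.add (S.actR x f) (S.actR x' f) h2
  actL_add : ∀ {A B B' : C} (y y' : S.H A B) (h : S.dm y = S.cd y') (g : B ⟶ B')
      (h2 : S.dm (S.actL g y) = S.cd (S.actL g y')),
      S.actL g (S.add y y' h) = S.add (S.actL g y) (S.actL g y') h2
  actL_actL : ∀ {A B B' B'' : C} (g : B ⟶ B') (g' : B' ⟶ B'') (y : S.H A B),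
      S.actL g' (S.actL g y) = S.actL (g ≫ g') y
  actR_actR : ∀ {A'' A' A B : C} (x : S.H A B) (f : A' ⟶ A) (f' : A'' ⟶ A'),
      S.actR (S.actR x f) f' = S.actR x (f' ≫ f)
  actL_actR : ∀ {A' A B B' : C} (g : B ⟶ B') (x : S.H A B) (f : A' ⟶ A),
      S.actL g (S.actR x f) = S.actR (S.actL g x) f
  actL_id : ∀ {A B : C} (x : S.H A B), S.actL (𝟙 B) x = x
  actR_id : ∀ {A B : C} (x : S.H A B), S.actR x (𝟙 A) = x
  dm_zero : ∀ {A B : C} (f : A ⟶ B), S.dm (S.zero f) = f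
  cd_zero : ∀ {A B : C} (f : A ⟶ B), S.cd (S.zero f) = f
  dm_add : ∀ {A B : C} (x x' : S.H A B) (h), S.dm (S.add x x' h) = S.dm x'
  cd_add : ∀ {A B : C} (x x' : S.H A B) (h), S.cd (S.add x x' h) = S.cd x
  zero_add : ∀ {A B : C} (x : S.H A B) (h), S.add (S.zero (S.cd x)) x h = x
  add_zero : ∀ {A B : C} (x : S.H A B) (h), S.add x (S.zero (S.dm x)) h = x
  add_assoc : ∀ {A B : C} (x x' x'' : S.H A B) (h1 : S.dm x = S.cd x')
      (h2 : S.dm x' = S.cd x'') (h3) (h4),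
      S.add x (S.add x' x'' h2) h3 = S.add (S.add x x' h1) x'' h4
end TwoCellData

namespace TwoCellData
variable {C : Type u} [Category.{v} C]

/-- `δ` is natural with respect to `z`:
`cod(δ)·z + δ·dom(z) = δ·cod(z) + dom(δ)·z`. -/
def NatWrt (S : TwoCellData C) {X A B : C} (δ : S.H A B) (z : S.H X A) : Prop :=
  ∀ (h1 : S.dm (S.actL (S.cd δ) z) = S.cd (S.actR δ (S.dm z)))
    (h2 : S.dm (S.actR δ (S.cd z)) = S.cd (S.actL (S.dm δ) z)),
    S.add (S.actL (S.cd δ) z) (S.actR δ (S.dm z)) h1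
      = S.add (S.actR δ (S.cd z)) (S.actL (S.dm δ) z) h2

/-- The naturality condition for every pair of (horizontally composable) 2-cells. -/
def NatCond (S : TwoCellData C) : Prop :=
  ∀ {A B B' : C} (x : S.H B B') (y : S.H A B), S.NatWrt x y

end TwoCellData

/-- A horizontal composition operation turning a category with a 2-cell structure
into a 2-category: it is compatible with `dom`/`cod`, restricts to the
whiskerings (the actions) on identity 2-cells, is associative, and satisfies the
middle interchange law with respect to vertical composition. -/
structure HorizontalComp {C : Type u} [Category.{v} C] (S : TwoCellData C) where
  hcomp : ∀ {A B B' : C}, S.H B B' → S.H A B → S.H A B'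
  dm_hcomp : ∀ {A B B' : C} (x : S.H B B') (y : S.H A B),
      S.dm (hcomp x y) = S.dm y ≫ S.dm x
  cd_hcomp : ∀ {A B B' : C} (x : S.H B B') (y : S.H A B),
      S.cd (hcomp x y) = S.cd y ≫ S.cd x
  hcomp_zero_left : ∀ {A B B' : C} (g : B ⟶ B') (y : S.H A B),
      hcomp (S.zero g) y = S.actL g y
  hcomp_zero_right : ∀ {A B B' : C} (x : S.H B B') (f : A ⟶ B),
      hcomp x (S.zero f) = S.actR x f
  hcomp_assoc : ∀ {A B B' B'' : C} (x : S.H B' B'') (y : S.H B B') (z : S.H A B),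
      hcomp x (hcomp y z) = hcomp (hcomp x y) z
  interchange : ∀ {A B B' : C} (x x' : S.H B B') (y y' : S.H A B)
      (hx : S.dm x = S.cd x') (hy : S.dm y = S.cd y')
      (hxy : S.dm (hcomp x y) = S.cd (hcomp x' y')),
      hcomp (S.add x x' hx) (S.add y y' hy) = S.add (hcomp x y) (hcomp x' y') hxy

namespace TwoCellData
variable {C : Type u} [Category.{v} C] {S : TwoCellData C}

theorem add_congr {A B : C} {x x' y y' : S.H A B} (hx : x = y) (hx' : x' = y')
    (h : S.dm x = S.cd x') (h' : S.dm y = S.cd y') : S.add x x' h = S.add y y' h' := by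
  subst hx hx'
  rfl

namespace Lawful

theorem dm_actL_cd (hS : S.Lawful) {A B B' : C} (x : S.H B B') (y : S.H A B) :
    S.dm (S.actL (S.cd x) y) = S.cd (S.actR x (S.dm y)) := by
  rw [hS.dm_actL, hS.cd_actR]

theorem dm_actR_cd (hS : S.Lawful) {A B B' : C} (x : S.H B B') (y : S.H A B) :
    S.dm (S.actR x (S.cd y)) = S.cd (S.actL (S.dm x) y) := by
  rw [hS.dm_actR, hS.cd_actL]

theorem zero_add_of_eq (hS : S.Lawful) {A B : C} (f : A ⟶ B) (x : S.H A B) (hf : f = S.cd x)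
    (h : S.dm (S.zero f) = S.cd x) : S.add (S.zero f) x h = x := by
  subst hf
  exact hS.zero_add x h

theorem add_zero_of_eq (hS : S.Lawful) {A B : C} (x : S.H A B) (f : A ⟶ B) (hf : f = S.dm x)
    (h : S.dm x = S.cd (S.zero f)) : S.add x (S.zero f) h = x := by
  subst hf
  exact hS.add_zero x h

/-- The sum of four composable 2-cells, rebracketed around the two middle ones. -/
theorem add_add_add (hS : S.Lawful) {A B : C} (a b c d : S.H A B)
    (hab : S.dm a = S.cd b) (hbc : S.dm b = S.cd c) (hcd : S.dm c = S.cd d)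
    (h : S.dm (S.add a b hab) = S.cd (S.add c d hcd))
    (h₁ : S.dm (S.add b c hbc) = S.cd d)
    (h₂ : S.dm a = S.cd (S.add (S.add b c hbc) d h₁)) :
    S.add (S.add a b hab) (S.add c d hcd) h = S.add a (S.add (S.add b c hbc) d h₁) h₂ := by
  have h₃ : S.dm b = S.cd (S.add c d hcd) := by rw [hS.cd_add, hbc]
  have h₄ : S.dm a = S.cd (S.add b (S.add c d hcd) h₃) := by rw [hS.cd_add, hab]
  rw [← hS.add_assoc a b (S.add c d hcd) hab h₃ h₄ h]
  exact add_congr rfl (hS.add_assoc b c d hbc hcd h₃ h₁) _ _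

end Lawful

/-- The composite `cod(x)y + x·dom(y)` of two horizontally composable 2-cells. -/
def whiskerComp (hS : S.Lawful) {A B B' : C} (x : S.H B B') (y : S.H A B) : S.H A B' :=
  S.add (S.actL (S.cd x) y) (S.actR x (S.dm y)) (hS.dm_actL_cd x y)

theorem dm_whiskerComp (hS : S.Lawful) {A B B' : C} (x : S.H B B') (y : S.H A B) :
    S.dm (whiskerComp hS x y) = S.dm y ≫ S.dm x := by
  rw [whiskerComp, hS.dm_add, hS.dm_actR]

theorem cd_whiskerComp (hS : S.Lawful) {A B B' : C} (x : S.H B B') (y : S.H A B) :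
    S.cd (whiskerComp hS x y) = S.cd y ≫ S.cd x := by
  rw [whiskerComp, hS.cd_add, hS.cd_actL]

theorem whiskerComp_assoc (hS : S.Lawful) {A B B' B'' : C} (x : S.H B' B'') (y : S.H B B')
    (z : S.H A B) :
    whiskerComp hS x (whiskerComp hS y z) = whiskerComp hS (whiskerComp hS x y) z := by
  have h₁ : S.dm (S.actL (S.cd y ≫ S.cd x) z) = S.cd (S.actR (S.actL (S.cd x) y) (S.dm z)) := by
    simp [hS.dm_actL, hS.cd_actL, hS.cd_actR]
  have h₂ : S.dm (S.actR (S.actL (S.cd x) y) (S.dm z)) = S.cd (S.actR x (S.dm z ≫ S.dm y)) := by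
    simp [hS.dm_actL, hS.dm_actR, hS.cd_actR]
  have h₃ := (hS.dm_add _ _ h₁).trans h₂
  have h₄ := h₁.trans (hS.cd_add _ _ h₂).symm
  have left : whiskerComp hS x (whiskerComp hS y z) = S.add (S.add _ _ h₁) _ h₃ := by
    refine add_congr ?_ (by rw [dm_whiskerComp]) _ _
    rw [whiskerComp, hS.actL_add _ _ _ _ (by simp [hS.dm_actL, hS.cd_actL, hS.cd_actR])]
    exact add_congr (hS.actL_actL _ _ _) (hS.actL_actR _ _ _) _ _
  have right : whiskerComp hS (whiskerComp hS x y) z = S.add _ (S.add _ _ h₂) h₄ := by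
    refine add_congr (by rw [cd_whiskerComp]) ?_ _ _
    rw [whiskerComp, hS.actR_add _ _ _ _ (by simp [hS.dm_actL, hS.dm_actR, hS.cd_actR])]
    exact add_congr rfl (hS.actR_actR _ _ _) _ _
  rw [left, right, hS.add_assoc]

/-- The middle interchange law follows from the naturality condition. -/
theorem NatCond.whiskerComp_add_add (hN : S.NatCond) (hS : S.Lawful) {A B B' : C}
    (x x' : S.H B B') (y y' : S.H A B) (hx : S.dm x = S.cd x') (hy : S.dm y = S.cd y')
    (hxy : S.dm (whiskerComp hS x y) = S.cd (whiskerComp hS x' y')) :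
    whiskerComp hS (S.add x x' hx) (S.add y y' hy) =
      S.add (whiskerComp hS x y) (whiskerComp hS x' y') hxy := by
  have hL : S.dm (S.actL (S.cd x) y) = S.cd (S.actL (S.cd x) y') := by
    rw [hS.dm_actL, hS.cd_actL, hy]
  have hR : S.dm (S.actR x (S.dm y')) = S.cd (S.actR x' (S.dm y')) := by
    rw [hS.dm_actR, hS.cd_actR, hx]
  have hM : S.dm (S.actR x (S.dm y)) = S.cd (S.actL (S.cd x') y') := by
    rw [hS.dm_actR, hS.cd_actL, hx, hy]
  have middle : S.add (S.actL (S.cd x) y') (S.actR x (S.dm y')) (hS.dm_actL_cd x y') =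
      S.add (S.actR x (S.dm y)) (S.actL (S.cd x') y') hM := by
    rw [hN x y' (hS.dm_actL_cd x y') (hS.dm_actR_cd x y')]
    exact add_congr (by rw [hy]) (by rw [hx]) _ _
  have expand : whiskerComp hS (S.add x x' hx) (S.add y y' hy) =
      S.add (S.add _ _ hL) (S.add _ _ hR)
        (by rw [hS.dm_add, hS.cd_add]; exact hS.dm_actL_cd x y') := by
    refine add_congr ?_ ?_ _ _
    · rw [hS.cd_add, hS.actL_add]
    · rw [hS.dm_add, hS.actR_add]
  rw [expand, hS.add_add_add _ _ _ _ hL (hS.dm_actL_cd x y') hR _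
    (by rw [hS.dm_add, hR]) (by rw [hS.cd_add, hS.cd_add, hL])]
  refine Eq.trans ?_ (hS.add_add_add _ _ _ _ (hS.dm_actL_cd x y) hM (hS.dm_actL_cd x' y') hxy
    (by rw [hS.dm_add, hS.dm_actL_cd]) (by rw [hS.cd_add, hS.cd_add, hS.dm_actL_cd])).symm
  exact add_congr rfl (add_congr middle rfl _ _) _ _

/-- The horizontal composition determined by the naturality condition. -/
def NatCond.horizontalComp (hN : S.NatCond) (hS : S.Lawful) : HorizontalComp S where
  hcomp := whiskerComp hS
  dm_hcomp := dm_whiskerComp hS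
  cd_hcomp := cd_whiskerComp hS
  hcomp_zero_left g y := by
    simp only [whiskerComp, hS.actR_zero, hS.cd_zero]
    exact hS.add_zero_of_eq _ _ (hS.dm_actL g y).symm _
  hcomp_zero_right x f := by
    simp only [whiskerComp, hS.actL_zero, hS.dm_zero]
    exact hS.zero_add_of_eq _ _ (hS.cd_actR x f).symm _
  hcomp_assoc := whiskerComp_assoc hS
  interchange := hN.whiskerComp_add_add hS

end TwoCellData

namespace HorizontalComp
variable {C : Type u} [Category.{v} C] {S : TwoCellData C}

theorem hcomp_eq_actL_add_actR (hc : HorizontalComp S) (hS : S.Lawful) {A B B' : C}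
    (x : S.H B B') (y : S.H A B)
    (h : S.dm (S.actL (S.cd x) y) = S.cd (S.actR x (S.dm y))) :
    hc.hcomp x y = S.add (S.actL (S.cd x) y) (S.actR x (S.dm y)) h := by
  have key := hc.interchange (S.zero (S.cd x)) x y (S.zero (S.dm y)) (hS.dm_zero _)
    (hS.cd_zero _).symm (by rw [hc.hcomp_zero_left, hc.hcomp_zero_right, h])
  rw [hS.zero_add, hS.add_zero] at key
  exact key.trans
    (TwoCellData.add_congr (hc.hcomp_zero_left _ _) (hc.hcomp_zero_right _ _) _ _)

theorem hcomp_eq_actR_add_actL (hc : HorizontalComp S) (hS : S.Lawful) {A B B' : C}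
    (x : S.H B B') (y : S.H A B)
    (h : S.dm (S.actR x (S.cd y)) = S.cd (S.actL (S.dm x) y)) :
    hc.hcomp x y = S.add (S.actR x (S.cd y)) (S.actL (S.dm x) y) h := by
  have key := hc.interchange x (S.zero (S.dm x)) (S.zero (S.cd y)) y (hS.cd_zero _).symm
    (hS.dm_zero _) (by rw [hc.hcomp_zero_left, hc.hcomp_zero_right, h])
  rw [hS.zero_add, hS.add_zero] at key
  exact key.trans
    (TwoCellData.add_congr (hc.hcomp_zero_right _ _) (hc.hcomp_zero_left _ _) _ _)

end HorizontalComp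

/-- A category `C` with a 2-cell structure is a 2-category
(i.e. admits a horizontal composition making it a 2-category) if and only if
the naturality condition `cod(x)y + x·dom(y) = x·cod(y) + dom(x)y` holds for
all 2-cells `x ∈ H(B,C)`, `y ∈ H(A,B)`; in that case the horizontal
composition is necessarily given by either side of the naturality condition
(the middle interchange law being part of the 2-category structure). -/
theorem twoCategory_iff_natCond {C : Type u} [Category.{v} C]
    (S : TwoCellData C) (hS : S.Lawful) :
    (Nonempty (HorizontalComp S) ↔ S.NatCond) ∧
    (∀ (hc : HorizontalComp S) {A B B' : C} (x : S.H B B') (y : S.H A B)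
        (h1 : S.dm (S.actL (S.cd x) y) = S.cd (S.actR x (S.dm y)))
        (h2 : S.dm (S.actR x (S.cd y)) = S.cd (S.actL (S.dm x) y)),
      hc.hcomp x y = S.add (S.actL (S.cd x) y) (S.actR x (S.dm y)) h1 ∧
      hc.hcomp x y = S.add (S.actR x (S.cd y)) (S.actL (S.dm x) y) h2) := by
  refine ⟨⟨?_, fun hN => ⟨hN.horizontalComp hS⟩⟩, fun hc _ _ _ x y h1 h2 =>
    ⟨hc.hcomp_eq_actL_add_actR hS x y h1, hc.hcomp_eq_actR_add_actL hS x y h2⟩⟩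
  rintro ⟨hc⟩ A B B' x y h1 h2
  rw [← hc.hcomp_eq_actL_add_actR hS x y h1, hc.hcomp_eq_actR_add_actL hS x y h2]
end

section
/- Let C be a category, H: C^op × C → Mon a functor into monoids, and D: UH × hom_C → hom_C a natural transformation (U the forgetful functor Mon → Set) satisfying D(0,f) = f and D(x'+x, f) = D(x', D(x,f)) for all f: A → B and x, x' ∈ H(A,B). Then setting the 2-cells from f to D(x,f) to be the pairs (x,f), with vertical composition (x', D(x,f)) + (x,f) = (x'+x, f), identities (0,f), and actions g(x,f)h = (H(h,g)(x), gfh), defines a 2-cell structure on C. If moreover D(y,g)x + yf = yD(x,f) + gx for all composable x, y, f, g, then the resulting structure is a 2-category. -/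
open CategoryTheory Opposite

universe v u

variable {C : Type u} [Category.{v} C]

/-- The 2-cell data associated with a functor `H : Cᵒᵖ × C ⥤ Mon` and an
"action" `D : UH × hom ⟶ hom`: a 2-cell from `f` to `D(x,f)` is a pair
`(x,f)`, vertical composition is `(x', D(x,f)) + (x,f) = (x'+x, f)`,
identities are `(0,f)` and the actions are `g·(x,f)·h = (H(h,g)(x), g f h)`. -/
def monActData (Hf : Cᵒᵖ × C ⥤ AddMonCat.{v})
    (D : ∀ {A B : C}, Hf.obj (op A, B) → (A ⟶ B) → (A ⟶ B)) : TwoCellData C where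
  H A B := Hf.obj (op A, B) × (A ⟶ B)
  dm p := p.2
  cd p := D p.1 p.2
  zero f := (0, f)
  add p p' _ := (p.1 + p'.1, p'.2)
  actL := fun {A B B'} g p =>
    (Hf.map (((𝟙 (op A), g) : (op A, B) ⟶ (op A, B'))) p.1, p.2 ≫ g)
  actR := fun {A' A B} p f =>
    (Hf.map (((f.op, 𝟙 B) : (op A, B) ⟶ (op A', B))) p.1, f ≫ p.2)

theorem map_id_left_comp (Hf : Cᵒᵖ × C ⥤ AddMonCat.{v}) {A B B' B'' : C}
    (g : B ⟶ B') (g' : B' ⟶ B'') (x : Hf.obj (op A, B)) :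
    Hf.map (((𝟙 (op A), g') : (op A, B') ⟶ (op A, B'')))
        (Hf.map (((𝟙 (op A), g) : (op A, B) ⟶ (op A, B'))) x)
      = Hf.map (((𝟙 (op A), g ≫ g') : (op A, B) ⟶ (op A, B''))) x := by
  rw [← ConcreteCategory.comp_apply, ← Hf.map_comp]
  exact congrArg (fun k => Hf.map k x) (Prod.ext (Category.id_comp _) rfl)

theorem map_id_right_comp (Hf : Cᵒᵖ × C ⥤ AddMonCat.{v}) {A'' A' A B : C}
    (f : A' ⟶ A) (f' : A'' ⟶ A') (x : Hf.obj (op A, B)) :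
    Hf.map (((f'.op, 𝟙 B) : (op A', B) ⟶ (op A'', B)))
        (Hf.map (((f.op, 𝟙 B) : (op A, B) ⟶ (op A', B))) x)
      = Hf.map ((((f' ≫ f).op, 𝟙 B) : (op A, B) ⟶ (op A'', B))) x := by
  rw [← ConcreteCategory.comp_apply, ← Hf.map_comp]
  exact congrArg (fun k => Hf.map k x) (Prod.ext rfl (Category.id_comp _))

theorem map_left_right_comm (Hf : Cᵒᵖ × C ⥤ AddMonCat.{v}) {A' A B B' : C}
    (f : A' ⟶ A) (g : B ⟶ B') (x : Hf.obj (op A, B)) :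
    Hf.map (((𝟙 (op A'), g) : (op A', B) ⟶ (op A', B')))
        (Hf.map (((f.op, 𝟙 B) : (op A, B) ⟶ (op A', B))) x)
      = Hf.map (((f.op, 𝟙 B') : (op A, B') ⟶ (op A', B')))
        (Hf.map (((𝟙 (op A), g) : (op A, B) ⟶ (op A, B'))) x) := by
  rw [← ConcreteCategory.comp_apply, ← ConcreteCategory.comp_apply, ← Hf.map_comp, ← Hf.map_comp]
  simp

theorem map_id_id_apply (Hf : Cᵒᵖ × C ⥤ AddMonCat.{v}) {A B : C} (x : Hf.obj (op A, B)) :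
    Hf.map (((𝟙 (op A), 𝟙 B) : (op A, B) ⟶ (op A, B))) x = x := by
  change Hf.map (𝟙 (op A, B)) x = x
  rw [Hf.map_id]
  rfl

/-- Given a functor `H : Cᵒᵖ × C ⥤ Mon` and a natural
transformation `D : UH × hom ⟶ hom` with `D(0,f) = f` and
`D(x'+x,f) = D(x', D(x,f))`, the data above defines a 2-cell structure on `C`;
if moreover `D(y,g)x + yf = yD(x,f) + gx` for all composable `x, y, f, g`,
the resulting structure is a 2-category. -/
theorem monActData_lawful_and_twoCategory
    (Hf : Cᵒᵖ × C ⥤ AddMonCat.{v})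
    (D : ∀ {A B : C}, Hf.obj (op A, B) → (A ⟶ B) → (A ⟶ B))
    (hDnat : ∀ {A' A B B' : C} (f : A' ⟶ A) (g : B ⟶ B')
        (x : Hf.obj (op A, B)) (φ : A ⟶ B),
        D (Hf.map (f.op, g) x) (f ≫ φ ≫ g) = f ≫ D x φ ≫ g)
    (hD0 : ∀ {A B : C} (f : A ⟶ B), D (0 : Hf.obj (op A, B)) f = f)
    (hDadd : ∀ {A B : C} (x x' : Hf.obj (op A, B)) (f : A ⟶ B),
        D (x' + x) f = D x' (D x f)) :
    (monActData Hf @D).Lawful ∧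
    ((∀ {A B B' : C} (f : A ⟶ B) (g : B ⟶ B')
        (x : Hf.obj (op A, B)) (y : Hf.obj (op B, B')),
        Hf.map (((𝟙 (op A), D y g) : (op A, B) ⟶ (op A, B'))) x
            + Hf.map (((f.op, 𝟙 B') : (op B, B') ⟶ (op A, B'))) y
          = Hf.map ((((D x f).op, 𝟙 B') : (op B, B') ⟶ (op A, B'))) y
            + Hf.map (((𝟙 (op A), g) : (op A, B) ⟶ (op A, B'))) x) →
      Nonempty (HorizontalComp (monActData Hf @D))) := by
  have hDL {A B B' : C} (g : B ⟶ B') (x : Hf.obj (op A, B)) (φ : A ⟶ B) :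
      D (Hf.map (((𝟙 (op A), g) : (op A, B) ⟶ (op A, B'))) x) (φ ≫ g) = D x φ ≫ g := by
    simpa using hDnat (𝟙 A) g x φ
  have hDR {A' A B : C} (f : A' ⟶ A) (x : Hf.obj (op A, B)) (φ : A ⟶ B) :
      D (Hf.map (((f.op, 𝟙 B) : (op A, B) ⟶ (op A', B))) x) (f ≫ φ) = f ≫ D x φ := by
    simpa using hDnat f (𝟙 B) x φ
  refine ⟨?_, fun hnat => ?_⟩
  · constructor
    case dm_actL => intros; rfl
    case dm_actR => intros; rfl
    case cd_actL => intros; exact hDL _ _ _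
    case cd_actR => intros; exact hDR _ _ _
    case actL_zero => intros; exact Prod.ext (map_zero _) rfl
    case actR_zero => intros; exact Prod.ext (map_zero _) rfl
    case actR_add => intros; exact Prod.ext (map_add _ _ _) rfl
    case actL_add => intros; exact Prod.ext (map_add _ _ _) rfl
    case actL_actL => intros; exact Prod.ext (map_id_left_comp _ _ _ _) (Category.assoc _ _ _)
    case actR_actR =>
      intros; exact Prod.ext (map_id_right_comp _ _ _ _) (Category.assoc _ _ _).symm
    case actL_actR => intros; exact Prod.ext (map_left_right_comm _ _ _ _) (Category.assoc _ _ _)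
    case actL_id => intros; exact Prod.ext (map_id_id_apply _ _) (Category.comp_id _)
    case actR_id => intros; exact Prod.ext (map_id_id_apply _ _) (Category.id_comp _)
    case dm_zero => intros; rfl
    case cd_zero => intros; exact hD0 _
    case dm_add => intros; rfl
    case cd_add =>
      rintro A B ⟨x, f⟩ ⟨x', f'⟩ (rfl : f = D x' f')
      exact hDadd _ _ _
    case zero_add => intros; exact Prod.ext (zero_add _) rfl
    case add_zero => intros; exact Prod.ext (add_zero _) rfl
    case add_assoc => intros; exact Prod.ext (add_assoc _ _ _).symm rfl
  · have hDcomp {A B B' : C} (y : Hf.obj (op B, B')) (g : B ⟶ B') (x : Hf.obj (op A, B))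
        (f : A ⟶ B) :
        D (Hf.map (((𝟙 (op A), D y g) : (op A, B) ⟶ (op A, B'))) x
          + Hf.map (((f.op, 𝟙 B') : (op B, B') ⟶ (op A, B'))) y) (f ≫ g) = D x f ≫ D y g := by
      rw [hDadd, hDR, hDL]
    refine ⟨{
      hcomp := fun {A B B'} y x =>
        (Hf.map (((𝟙 (op A), D y.1 y.2) : (op A, B) ⟶ (op A, B'))) x.1
          + Hf.map (((x.2.op, 𝟙 B') : (op B, B') ⟶ (op A, B'))) y.1, x.2 ≫ y.2)
      dm_hcomp := fun _ _ => rfl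
      cd_hcomp := fun _ _ => hDcomp _ _ _ _
      hcomp_zero_left := ?_
      hcomp_zero_right := ?_
      hcomp_assoc := ?_
      interchange := ?_ }⟩
    · rintro A B B' g ⟨x, f⟩
      refine Prod.ext ?_ rfl
      simp [monActData, hD0]
    · rintro A B B' ⟨y, g⟩ f
      refine Prod.ext ?_ rfl
      simp [monActData]
    · rintro A B B' B'' ⟨x, p⟩ ⟨y, q⟩ ⟨z, r⟩
      refine Prod.ext ?_ (Category.assoc _ _ _)
      dsimp only
      rw [hDcomp, map_add, map_add, map_id_left_comp, map_left_right_comm, map_id_right_comp,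
        add_assoc]
    · rintro A B B' ⟨x, p⟩ ⟨x', p'⟩ ⟨y, q⟩ ⟨y', q'⟩ (rfl : p = D x' p') (rfl : q = D y' q') _
      refine Prod.ext ?_ rfl
      dsimp only [monActData]
      rw [hDadd, map_add, map_add, add_assoc, add_assoc, ← add_assoc (Hf.map _ y'), hnat,
        add_assoc]
end

section
/- Let A = (d: X → B, φ) and A' = (d': X' → B', φ') be crossed modules, f = (f_1, f_0): A → A' a morphism of crossed modules, and t: UB → UX' a map of underlying sets such that the pair (td + f_1, dt + f_0) is well defined (i.e. (dt+f_0)d = d'(td+f_1)). Then (td + f_1, d't + f_0) is a morphism of crossed modules A → A' if and only if: (i) d't + f_0 is a group homomorphism, equivalently d't(bb') = d'(t(b) + f_0(b)·t(b')) for all b, b' ∈ B; (ii) td + f_1 is a group homomorphism, equivalently t(d(x)d(x')) = t(dx) + f_0 d(x)·td(x') for all x, x' ∈ X; and (iii) td + f_1 preserves the action of d't + f_0, equivalently t(b d(x) b^{-1}) = t(b) + f_0(b)·t(d(x)) + f_0(b d(x) b^{-1})·(−t(b)) for all b ∈ B, x ∈ X. Moreover, for t in the group of derivations (maps t: B → X'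 with t(bb') = t(b) + f_0(b)·t(b'))), the commutativity of the defining square holds automatically since (f_1, f_0) is a morphism. -/
/-!  Crossed modules.  A crossed module `(d : X → B, φ)` is a group
homomorphism `d` together with an action `φ` of `B` on `X` (by automorphisms)
satisfying `d(b·x) = b d(x) b⁻¹` and `d(x)·x' = x x' x⁻¹`.  -/

/-- Let `A = (d : X → B, φ)` and `A' = (d' : X' → B', φ')` be
crossed modules, `f = (f₁, f₀) : A → A'` a morphism of crossed modules and
`t : B → X'` a map of underlying sets such that the pair
`(td + f₁, d't + f₀)` is well defined (the defining square commutes).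
Then `(td + f₁, d't + f₀)` is a morphism of crossed modules if and only if
(i) `d't + f₀` is a group homomorphism, equivalently
`d't(bb') = d'(t(b) + f₀(b)·t(b'))`;
(ii) `td + f₁` is a group homomorphism, equivalently
`t(d(x)d(x')) = t(dx) + f₀d(x)·td(x')`; and
(iii) `td + f₁` preserves the action of `d't + f₀`, equivalently
`t(b d(x) b⁻¹) = t(b) + f₀(b)·t(dx) + f₀(b d(x) b⁻¹)·(−t(b))`.
Moreover the commutativity of the defining square holds automatically
(in particular for any derivation `t`), since `(f₁, f₀)` is a morphism.
(Everything is written multiplicatively.) -/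
theorem crossedModule_homotopy_morphism_iff
    {X B X' B' : Type*} [Group X] [Group B] [Group X'] [Group B']
    (d : X →* B) (d' : X' →* B')
    (φ : B →* MulAut X) (φ' : B' →* MulAut X')
    -- crossed module axioms for A
    (hpeif : ∀ b x, d (φ b x) = b * d x * b⁻¹)
    (hpeif2 : ∀ x x', φ (d x) x' = x * x' * x⁻¹)
    -- crossed module axioms for A'
    (hpeif' : ∀ b' x', d' (φ' b' x') = b' * d' x' * b'⁻¹)
    (hpeif2' : ∀ x' x'', φ' (d' x') x'' = x' * x'' * x'⁻¹)
    -- f = (f₁, f₀) is a morphism of crossed modules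
    (f₁ : X →* X') (f₀ : B →* B')
    (hf : ∀ x, f₀ (d x) = d' (f₁ x))
    (hfa : ∀ b x, f₁ (φ b x) = φ' (f₀ b) (f₁ x))
    -- the pair (td + f₁ , d't + f₀) is well defined:
    (t : B → X')
    (hwd : ∀ x : X, d' (t (d x)) * f₀ (d x) = d' (t (d x) * f₁ x)) :
    -- main equivalence: morphism of crossed modules ↔ (i) ∧ (ii) ∧ (iii)
    (((∀ b b' : B, d' (t (b * b')) * f₀ (b * b')
          = (d' (t b) * f₀ b) * (d' (t b') * f₀ b')) ∧
      (∀ x x' : X, t (d (x * x')) * f₁ (x * x')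
          = (t (d x) * f₁ x) * (t (d x') * f₁ x')) ∧
      (∀ x : X, d' (t (d x)) * f₀ (d x) = d' (t (d x) * f₁ x)) ∧
      (∀ (b : B) (x : X),
          t (d (φ b x)) * f₁ (φ b x)
            = φ' (d' (t b) * f₀ b) (t (d x) * f₁ x)))
      ↔
     ((∀ b b' : B, d' (t (b * b')) = d' (t b * φ' (f₀ b) (t b'))) ∧
      (∀ x x' : X, t (d x * d x') = t (d x) * φ' (f₀ (d x)) (t (d x'))) ∧
      (∀ (b : B) (x : X),
          t (b * d x * b⁻¹)
            = t b * φ' (f₀ b) (t (d x)) * φ' (f₀ (b * d x * b⁻¹)) (t b)⁻¹))) ∧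
    -- the "equivalently" clauses of (i), (ii), (iii) separately:
    ((∀ b b' : B, d' (t (b * b')) * f₀ (b * b')
          = (d' (t b) * f₀ b) * (d' (t b') * f₀ b'))
      ↔ (∀ b b' : B, d' (t (b * b')) = d' (t b * φ' (f₀ b) (t b')))) ∧
    ((∀ x x' : X, t (d (x * x')) * f₁ (x * x')
          = (t (d x) * f₁ x) * (t (d x') * f₁ x'))
      ↔ (∀ x x' : X, t (d x * d x') = t (d x) * φ' (f₀ (d x)) (t (d x')))) ∧
    ((∀ (b : B) (x : X),
          t (d (φ b x)) * f₁ (φ b x)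
            = φ' (d' (t b) * f₀ b) (t (d x) * f₁ x))
      ↔ (∀ (b : B) (x : X),
          t (b * d x * b⁻¹)
            = t b * φ' (f₀ b) (t (d x)) * φ' (f₀ (b * d x * b⁻¹)) (t b)⁻¹)) ∧
    -- commutativity of the defining square holds automatically, in particular
    -- for every `t` in the group of derivations:
    ((∀ b b' : B, t (b * b') = t b * φ' (f₀ b) (t b')) →
      ∀ x : X, d' (t (d x)) * f₀ (d x) = d' (t (d x) * f₁ x)) := by
  have hom₀ (b b' : B) :
      d' (t (b * b')) * f₀ (b * b') = (d' (t b) * f₀ b) * (d' (t b') * f₀ b')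
        ↔ d' (t (b * b')) = d' (t b * φ' (f₀ b) (t b')) := by
    rw [← mul_left_inj (f₀ (b * b')) (b := d' (t (b * b'))), map_mul d', hpeif', map_mul f₀]
    simp only [mul_assoc, inv_mul_cancel_left]
  have hom₁ (x x' : X) :
      t (d (x * x')) * f₁ (x * x') = (t (d x) * f₁ x) * (t (d x') * f₁ x')
        ↔ t (d x * d x') = t (d x) * φ' (f₀ (d x)) (t (d x')) := by
    rw [← mul_left_inj (f₁ (x * x')) (b := t (d x * d x')), hf, hpeif2', map_mul d, map_mul f₁]
    simp only [mul_assoc, inv_mul_cancel_left]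
  have equivariant (b : B) (x : X) :
      t (d (φ b x)) * f₁ (φ b x) = φ' (d' (t b) * f₀ b) (t (d x) * f₁ x)
        ↔ t (b * d x * b⁻¹)
            = t b * φ' (f₀ b) (t (d x)) * φ' (f₀ (b * d x * b⁻¹)) (t b)⁻¹ := by
    rw [← hpeif, hf, hpeif2', ← mul_left_inj (f₁ (φ b x)) (b := t (d (φ b x))), map_mul φ',
      MulAut.mul_apply, hpeif2', map_mul (φ' (f₀ b)), ← hfa]
    simp only [mul_assoc, inv_mul_cancel, mul_one]
  simp only [hom₀, hom₁, equivariant]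
  exact ⟨⟨fun ⟨h₀, h₁, _, h⟩ => ⟨h₀, h₁, h⟩, fun ⟨h₀, h₁, h⟩ => ⟨h₀, h₁, hwd, h⟩⟩,
    trivial, trivial, trivial, fun _ x => by rw [map_mul, hf]⟩
end

section
/- In the category of abelian chain complexes (of length 2), let x = (t_2, t_1) be a homotopy between chain maps B → C and y = (s_2, s_1) a homotopy between chain maps A → B, where the associated chain map of a homotopy (t_2, t_1) is D(t_2, t_1) = (t_2 d, t_1 d + d t_2, d t_1). Then D(x)y = (t_2 d s_2, d t_2 s_1 + t_1 d s_1) and x D(y) = (t_2 d s_2 + t_2 s_1 d, t_1 d s_1), so that the commutator is [x,y] = D(x)y − xD(y) = (−t_2 s_1 d, d t_2 s_1); in particular the condition D(x)y = xD(y) holds whenever t_2 s_1 = 0, but not in general. Consequently the 2-cell structure on abelian chain complexes given by homotopies is a sesquicategory that is not a 2-category. -/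
open CategoryTheory

universe v u

/-- An abelian chain complex of length 2:  `X₂ → X₁ → X₀` with `d d = 0`. -/
structure Cpx : Type 1 where
  X2 : Type
  X1 : Type
  X0 : Type
  [i2 : AddCommGroup X2]
  [i1 : AddCommGroup X1]
  [i0 : AddCommGroup X0]
  d2 : X2 →+ X1
  d1 : X1 →+ X0
  dd : d1.comp d2 = 0

attribute [instance] Cpx.i2 Cpx.i1 Cpx.i0

/-- A chain map between chain complexes of length 2. -/
@[ext]
structure ChainMap (A B : Cpx) where
  f2 : A.X2 →+ B.X2
  f1 : A.X1 →+ B.X1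
  f0 : A.X0 →+ B.X0
  c2 : B.d2.comp f2 = f1.comp A.d2
  c1 : B.d1.comp f1 = f0.comp A.d1

namespace ChainMap

def id (A : Cpx) : ChainMap A A :=
  ⟨AddMonoidHom.id _, AddMonoidHom.id _, AddMonoidHom.id _, by ext x; rfl, by ext x; rfl⟩

def comp {A B C : Cpx} (F : ChainMap A B) (G : ChainMap B C) : ChainMap A C where
  f2 := G.f2.comp F.f2
  f1 := G.f1.comp F.f1
  f0 := G.f0.comp F.f0
  c2 := by
    ext x
    have h1 := DFunLike.congr_fun G.c2 (F.f2 x)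
    have h2 := DFunLike.congr_fun F.c2 x
    simp only [AddMonoidHom.comp_apply] at *
    rw [h1, h2]
  c1 := by
    ext x
    have h1 := DFunLike.congr_fun G.c1 (F.f1 x)
    have h2 := DFunLike.congr_fun F.c1 x
    simp only [AddMonoidHom.comp_apply] at *
    rw [h1, h2]

/-- Pointwise addition of chain maps. -/
def add {A B : Cpx} (F G : ChainMap A B) : ChainMap A B where
  f2 := F.f2 + G.f2
  f1 := F.f1 + G.f1
  f0 := F.f0 + G.f0
  c2 := by
    ext x
    have h1 := DFunLike.congr_fun F.c2 x
    have h2 := DFunLike.congr_fun G.c2 x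
    simp only [AddMonoidHom.comp_apply, AddMonoidHom.add_apply, map_add] at *
    rw [h1, h2]
  c1 := by
    ext x
    have h1 := DFunLike.congr_fun F.c1 x
    have h2 := DFunLike.congr_fun G.c1 x
    simp only [AddMonoidHom.comp_apply, AddMonoidHom.add_apply, map_add] at *
    rw [h1, h2]

end ChainMap

instance : Category Cpx where
  Hom := ChainMap
  id := ChainMap.id
  comp := ChainMap.comp
  id_comp F := by apply ChainMap.ext <;> rfl
  comp_id F := by apply ChainMap.ext <;> rfl
  assoc F G H := by apply ChainMap.ext <;> rfl

/-- The data of a homotopy: a pair of homomorphisms `(t₂, t₁)`. -/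
def HtpyData (A B : Cpx) : Type :=
  (A.X1 →+ B.X2) × (A.X0 →+ B.X1)

instance (A B : Cpx) : AddCommGroup (HtpyData A B) := by
  unfold HtpyData; infer_instance

/-- The chain map `D(t₂,t₁) = (t₂d, t₁d + dt₂, dt₁)` associated with a
homotopy pair. -/
def Dmap {A B : Cpx} (t : HtpyData A B) : ChainMap A B where
  f2 := t.1.comp A.d2
  f1 := t.2.comp A.d1 + B.d2.comp t.1
  f0 := B.d1.comp t.2
  c2 := by
    ext x
    have h1 := DFunLike.congr_fun A.dd x
    simp only [AddMonoidHom.comp_apply, AddMonoidHom.add_apply,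
      AddMonoidHom.zero_apply] at *
    rw [h1]
    simp
  c1 := by
    ext x
    have h1 := DFunLike.congr_fun B.dd (t.1 x)
    simp only [AddMonoidHom.comp_apply, AddMonoidHom.add_apply,
      AddMonoidHom.zero_apply, map_add] at *
    rw [h1]
    simp

/-- Postcomposition of a homotopy with a chain map (`g·y`). -/
def postcomp {A B C : Cpx} (g : ChainMap B C) (y : HtpyData A B) : HtpyData A C :=
  (g.f2.comp y.1, g.f1.comp y.2)

/-- Precomposition of a homotopy with a chain map (`x·f`). -/
def precomp {A B C : Cpx} (x : HtpyData B C) (f : ChainMap A B) : HtpyData A C :=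
  (x.1.comp f.f1, x.2.comp f.f0)

/-- `(t₂,t₁)` is a homotopy from the chain map `f` to the chain map `g`. -/
def IsHomotopy {A B : Cpx} (f g : ChainMap A B) (t : HtpyData A B) : Prop :=
  g = ChainMap.add (Dmap t) f

/-- The 2-cell structure on abelian chain complexes given by homotopies:
a 2-cell is a pair `(f, t)` with domain `f` and codomain `D(t) + f`. -/
def cpxData : TwoCellData Cpx where
  H A B := ChainMap A B × HtpyData A B
  dm p := p.1
  cd p := ChainMap.add (Dmap p.2) p.1
  zero f := (f, 0)
  add x x' _ := (x'.1, x.2 + x'.2)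
  actL g p := (ChainMap.comp p.1 g, postcomp g p.2)
  actR p f := (ChainMap.comp f p.1, precomp p.2 f)

namespace HtpyData

variable {A B : Cpx}

@[ext]
theorem ext {s t : HtpyData A B} (h1 : ∀ a, s.1 a = t.1 a) (h2 : ∀ a, s.2 a = t.2 a) : s = t :=
  Prod.ext (AddMonoidHom.ext h1) (AddMonoidHom.ext h2)

@[simp]
theorem zero_fst : (0 : HtpyData A B).1 = 0 := rfl

@[simp]
theorem zero_snd : (0 : HtpyData A B).2 = 0 := rfl

@[simp]
theorem add_fst (s t : HtpyData A B) : (s + t).1 = s.1 + t.1 := rfl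

@[simp]
theorem add_snd (s t : HtpyData A B) : (s + t).2 = s.2 + t.2 := rfl

@[simp]
theorem sub_fst (s t : HtpyData A B) : (s - t).1 = s.1 - t.1 := rfl

@[simp]
theorem sub_snd (s t : HtpyData A B) : (s - t).2 = s.2 - t.2 := rfl

end HtpyData

namespace ChainMap

variable {A B : Cpx}

theorem f1_d2_apply (F : ChainMap A B) (a : A.X2) : F.f1 (A.d2 a) = B.d2 (F.f2 a) :=
  (DFunLike.congr_fun F.c2 a).symm

theorem f0_d1_apply (F : ChainMap A B) (a : A.X1) : F.f0 (A.d1 a) = B.d1 (F.f1 a) :=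
  (DFunLike.congr_fun F.c1 a).symm

protected theorem add_assoc (F G H : ChainMap A B) : add (add F G) H = add F (add G H) :=
  ChainMap.ext (_root_.add_assoc _ _ _) (_root_.add_assoc _ _ _) (_root_.add_assoc _ _ _)

theorem add_comp {C : Cpx} (F G : ChainMap A B) (K : ChainMap B C) :
    comp (add F G) K = add (comp F K) (comp G K) := by
  ext <;> simp [comp, add]

theorem comp_add {C : Cpx} (K : ChainMap A B) (F G : ChainMap B C) :
    comp K (add F G) = add (comp K F) (comp K G) := by
  ext <;> simp [comp, add]

end ChainMap

section Homotopy

variable {A B C : Cpx}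

@[simp]
theorem postcomp_fst (g : ChainMap B C) (y : HtpyData A B) :
    (postcomp g y).1 = g.f2.comp y.1 := rfl

@[simp]
theorem postcomp_snd (g : ChainMap B C) (y : HtpyData A B) :
    (postcomp g y).2 = g.f1.comp y.2 := rfl

@[simp]
theorem precomp_fst (x : HtpyData B C) (f : ChainMap A B) :
    (precomp x f).1 = x.1.comp f.f1 := rfl

@[simp]
theorem precomp_snd (x : HtpyData B C) (f : ChainMap A B) :
    (precomp x f).2 = x.2.comp f.f0 := rfl

theorem Dmap_zero_add (f : ChainMap A B) : ChainMap.add (Dmap 0) f = f := by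
  ext <;> simp [ChainMap.add, Dmap]

theorem Dmap_add (s t : HtpyData A B) : Dmap (s + t) = ChainMap.add (Dmap s) (Dmap t) := by
  ext <;> simp [ChainMap.add, Dmap]
  abel

theorem Dmap_postcomp (g : ChainMap B C) (y : HtpyData A B) :
    Dmap (postcomp g y) = ChainMap.comp (Dmap y) g := by
  ext <;> simp [ChainMap.comp, Dmap, g.f1_d2_apply, g.f0_d1_apply]

theorem Dmap_precomp (x : HtpyData B C) (f : ChainMap A B) :
    Dmap (precomp x f) = ChainMap.comp f (Dmap x) := by
  ext <;> simp [ChainMap.comp, Dmap, f.f1_d2_apply, f.f0_d1_apply]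

theorem postcomp_zero (g : ChainMap B C) : postcomp g (0 : HtpyData A B) = 0 := by
  ext <;> simp

theorem precomp_zero (f : ChainMap A B) : precomp (0 : HtpyData B C) f = 0 := by
  ext <;> simp

theorem postcomp_add (g : ChainMap B C) (y y' : HtpyData A B) :
    postcomp g (y + y') = postcomp g y + postcomp g y' := by
  ext <;> simp

theorem precomp_add (x x' : HtpyData B C) (f : ChainMap A B) :
    precomp (x + x') f = precomp x f + precomp x' f := by
  ext <;> simp

theorem postcomp_Dmap (x : HtpyData B C) (y : HtpyData A B) :
    postcomp (Dmap x) y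
      = (x.1.comp (B.d2.comp y.1),
         C.d2.comp (x.1.comp y.2) + x.2.comp (B.d1.comp y.2)) := by
  ext <;> simp [Dmap, add_comm]

theorem precomp_Dmap (x : HtpyData B C) (y : HtpyData A B) :
    precomp x (Dmap y)
      = (x.1.comp (B.d2.comp y.1) + x.1.comp (y.2.comp A.d1),
         x.2.comp (B.d1.comp y.2)) := by
  ext <;> simp [Dmap, add_comm]

theorem postcomp_Dmap_sub_precomp_Dmap (x : HtpyData B C) (y : HtpyData A B) :
    postcomp (Dmap x) y - precomp x (Dmap y)
      = (-(x.1.comp (y.2.comp A.d1)), C.d2.comp (x.1.comp y.2)) := by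
  ext <;> simp [Dmap]

theorem postcomp_Dmap_eq_precomp_Dmap (x : HtpyData B C) (y : HtpyData A B)
    (h : x.1.comp y.2 = 0) : postcomp (Dmap x) y = precomp x (Dmap y) := by
  rw [← sub_eq_zero, postcomp_Dmap_sub_precomp_Dmap, ← AddMonoidHom.comp_assoc, h]
  ext <;> simp

end Homotopy

theorem cpxData_lawful : cpxData.Lawful where
  dm_actL _ _ := rfl
  dm_actR _ _ := rfl
  cd_actL g y := (congrArg (ChainMap.add · _) (Dmap_postcomp g y.2)).trans
    (ChainMap.add_comp _ _ g).symm
  cd_actR x f := (congrArg (ChainMap.add · _) (Dmap_precomp x.2 f)).trans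
    (ChainMap.comp_add f _ _).symm
  actL_zero g _ := Prod.ext rfl (postcomp_zero g)
  actR_zero _ h := Prod.ext rfl (precomp_zero h)
  actR_add x x' _ f _ := Prod.ext rfl (precomp_add x.2 x'.2 f)
  actL_add y y' _ g _ := Prod.ext rfl (postcomp_add g y.2 y'.2)
  actL_actL _ _ _ := rfl
  actR_actR _ _ _ := rfl
  actL_actR _ _ _ := rfl
  actL_id _ := rfl
  actR_id _ := rfl
  dm_zero _ := rfl
  cd_zero f := Dmap_zero_add f
  dm_add _ _ _ := rfl
  cd_add x x' h := (congrArg (ChainMap.add · x'.1) (Dmap_add x.2 x'.2)).trans <|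
    (ChainMap.add_assoc _ _ _).trans (congrArg (ChainMap.add (Dmap x.2)) h.symm)
  zero_add x _ := Prod.ext rfl (zero_add x.2)
  add_zero x _ := Prod.ext rfl (add_zero x.2)
  add_assoc x x' x'' _ _ _ _ := Prod.ext rfl (add_assoc x.2 x'.2 x''.2).symm

/-- The complex `0 → 0 → ℤ`. -/
def intInDegreeZero : Cpx := ⟨PUnit, PUnit, ℤ, 0, 0, rfl⟩

/-- The complex `0 → ℤ → 0`. -/
def intInDegreeOne : Cpx := ⟨PUnit, ℤ, PUnit, 0, 0, rfl⟩

/-- The complex `ℤ → ℤ → 0` with identity differential. -/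
def intIdDegreeTwo : Cpx := ⟨ℤ, ℤ, PUnit, AddMonoidHom.id ℤ, 0, rfl⟩

theorem cpxData_not_natCond : ¬ cpxData.NatCond := by
  intro h
  let y : HtpyData intInDegreeZero intInDegreeOne := (0, AddMonoidHom.id ℤ)
  let x : HtpyData intInDegreeOne intIdDegreeTwo := (AddMonoidHom.id ℤ, 0)
  have key := h (A := intInDegreeZero) (B := intInDegreeOne) (B' := intIdDegreeTwo)
    (ChainMap.mk 0 0 0 (by ext; simp) (by ext; simp), x)
    (ChainMap.mk 0 0 0 (by ext; simp) (by ext; simp), y)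
    ((cpxData_lawful.dm_actL _ _).trans (cpxData_lawful.cd_actR _ _).symm)
    ((cpxData_lawful.dm_actR _ _).trans (cpxData_lawful.cd_actL _ _).symm)
  have h1 : (1 : ℤ) = 0 := DFunLike.congr_fun (congrArg (fun p => p.2.2) key) (1 : ℤ)
  exact one_ne_zero h1

/-- For homotopies `x = (t₂,t₁)` (between chain maps
`B → C`) and `y = (s₂,s₁)` (between chain maps `A → B`) one has
`D(x)y = (t₂ds₂, dt₂s₁ + t₁ds₁)` and `xD(y) = (t₂ds₂ + t₂s₁d, t₁ds₁)`,
so the commutator is `[x,y] = D(x)y − xD(y) = (−t₂s₁d, dt₂s₁)`;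
in particular `D(x)y = xD(y)` whenever `t₂s₁ = 0`, but not in general:
the 2-cell structure of homotopies is a (lawful) 2-cell structure
(sesquicategory) which is not a 2-category. -/
theorem chainComplex_homotopy_commutator :
    (∀ (A B C : Cpx) (f g : ChainMap B C) (f' g' : ChainMap A B)
        (x : HtpyData B C) (y : HtpyData A B),
        IsHomotopy f g x → IsHomotopy f' g' y →
        postcomp (Dmap x) y
            = (x.1.comp (B.d2.comp y.1),
               C.d2.comp (x.1.comp y.2) + x.2.comp (B.d1.comp y.2)) ∧
        precomp x (Dmap y)
            = (x.1.comp (B.d2.comp y.1) + x.1.comp (y.2.comp A.d1),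
               x.2.comp (B.d1.comp y.2)) ∧
        postcomp (Dmap x) y - precomp x (Dmap y)
            = (-(x.1.comp (y.2.comp A.d1)), C.d2.comp (x.1.comp y.2)) ∧
        (x.1.comp y.2 = 0 → postcomp (Dmap x) y = precomp x (Dmap y))) ∧
    cpxData.Lawful ∧
    ¬ cpxData.NatCond := by
  refine ⟨fun A B C _ _ _ _ x y _ _ => ⟨postcomp_Dmap x y, precomp_Dmap x y,
    postcomp_Dmap_sub_precomp_Dmap x y, postcomp_Dmap_eq_precomp_Dmap x y⟩,
    cpxData_lawful, cpxData_not_natCond⟩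
end

section
/- Let X, Y, Z be topological abelian groups, I = [0,1], and let α: I × Y → Z and β: I × X → Y be continuous maps such that α(0,·) = 0, β(0,·) = 0, and α(t,·), β(t,·) are group homomorphisms for every t ∈ I. Then the map Φ: I × I × X → Z defined by Φ(s,t,x) = α(t^{1−s}, β(t^s, x)) is continuous, each Φ(s,t,·) is a group homomorphism, and Φ satisfies Φ(0,t,x) = α(t, β(1,x)), Φ(1,t,x) = α(1, β(t,x)), Φ(s,0,x) = 0, and Φ(s,1,x) = α(1, β(1,x)). Consequently, in the 2-cell structure on topological abelian groups given by homotopy classes [α] of such maps (with equivalence α ∼ β iff α(1,·) = β(1,·) and there is such a Φ interpolating between them) and D([α]) = α(1,·), one has [α]·D([β]) = D([α])·[β], i.e. the condition D(x)y = xD(y) holds for all 2-cells. -/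
open unitInterval

/-- `t ^ s` inside the unit interval (real power). -/
noncomputable def ipow (t s : unitInterval) : unitInterval :=
  ⟨(t : ℝ) ^ (s : ℝ),
    Real.rpow_nonneg t.2.1 _,
    Real.rpow_le_one t.2.1 t.2.2 s.2.1⟩

/-- The relation of homotopy (of homotopies) between maps
`f g : I × X → Y` with `f(1,·) = g(1,·)`, through maps `Φ(s,t,·)` which are
homomorphisms, vanish at `t = 0` and are constantly `f(1,·)` at `t = 1`. -/
def HtpyRel {X Y : Type*} [AddCommGroup X] [AddCommGroup Y]
    [TopologicalSpace X] [TopologicalSpace Y]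
    (f g : unitInterval → X → Y) : Prop :=
  f 1 = g 1 ∧
  ∃ Φ : unitInterval → unitInterval → X → Y,
    Continuous (fun p : unitInterval × unitInterval × X => Φ p.1 p.2.1 p.2.2) ∧
    Φ 0 = f ∧ Φ 1 = g ∧
    (∀ s, Φ s 0 = fun _ => 0) ∧
    (∀ s, Φ s 1 = f 1) ∧
    (∀ s t (x x' : X), Φ s t (x + x') = Φ s t x + Φ s t x')

open Filter Topology

theorem ipow_zero_right (t : I) : ipow t 0 = 1 := by
  ext; simp [ipow]

theorem ipow_one_right (t : I) : ipow t 1 = t := by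
  ext; simp [ipow]

theorem ipow_one_left (s : I) : ipow 1 s = 1 := by
  ext; simp [ipow]

theorem ipow_symm_mul_ipow (t s : I) : ipow t (σ s) * ipow t s = t := by
  ext
  have h := Real.rpow_add_of_nonneg t.2.1 (σ s).2.1 s.2.1
  simpa [ipow] using h.symm

theorem continuousAt_ipow {t : I} (ht : t ≠ 0) (s : I) :
    ContinuousAt (fun p : I × I => ipow p.1 p.2) (t, s) := by
  have ht' : (t : ℝ) ≠ 0 := fun h => ht (Subtype.ext h)
  have hpow : ContinuousAt (fun p : ℝ × ℝ => p.1 ^ p.2) ((t : ℝ), (s : ℝ)) :=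
    Real.continuousAt_rpow _ (Or.inl ht')
  refine Topology.IsInducing.subtypeVal.continuousAt_iff.2 ?_
  exact hpow.comp (x := (t, s)) (f := fun p : I × I => ((p.1 : ℝ), (p.2 : ℝ)))
    (by fun_prop : Continuous fun p : I × I => ((p.1 : ℝ), (p.2 : ℝ))).continuousAt

/-- Although `ipow` is discontinuous at `(0, 0)`, composing `(t ^ (1 - s), t ^ s)` with a continuous
map that is constant on `{(u, v) | u * v = 0}` gives a continuous map. -/
theorem continuous_comp_ipow {X Z : Type*} [TopologicalSpace X] [TopologicalSpace Z]
    {F : I → I → X → Z} (hF : Continuous fun p : I × I × X => F p.1 p.2.1 p.2.2) {z : Z}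
    (hz : ∀ u v x, u * v = 0 → F u v x = z) :
    Continuous fun p : I × I × X => F (ipow p.2.1 (σ p.1)) (ipow p.2.1 p.1) p.2.2 := by
  refine continuous_iff_continuousAt.2 fun ⟨s, t, x⟩ => ?_
  by_cases ht : t = 0
  · subst ht
    refine tendsto_iff_ultrafilter _ _ _ |>.2 fun g hg => ?_
    have hid : Tendsto id (g : Filter (I × I × X)) (𝓝 (s, 0, x)) := hg
    obtain ⟨⟨u, v⟩, -, huv⟩ := isCompact_univ.ultrafilter_le_nhds
      (g.map fun p => (ipow p.2.1 (σ p.1), ipow p.2.1 p.1)) (by simp)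
    have huv' : Tendsto (fun p : I × I × X => (ipow p.2.1 (σ p.1), ipow p.2.1 p.1)) g
      (𝓝 (u, v)) := huv
    have hu := huv'.fst_nhds
    have hv := huv'.snd_nhds
    have hmul : u * v = 0 := by
      refine tendsto_nhds_unique (hu.mul hv) ?_
      simpa only [ipow_symm_mul_ipow, id] using hid.snd_nhds.fst_nhds
    have hlim := (hF.tendsto (u, v, x)).comp
      (hu.prodMk_nhds (hv.prodMk_nhds hid.snd_nhds.snd_nhds))
    have hval : F (ipow 0 (σ s)) (ipow 0 s) x = F u v x := by
      rw [hz _ _ _ hmul, hz _ _ _ (ipow_symm_mul_ipow 0 s)]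
    beta_reduce
    rw [hval]
    exact hlim
  · have hu : ContinuousAt (fun p : I × I × X => ipow p.2.1 (σ p.1)) (s, t, x) :=
      (continuousAt_ipow ht (σ s)).comp (x := (s, t, x))
        (f := fun p : I × I × X => (p.2.1, σ p.1)) (by fun_prop)
    have hv : ContinuousAt (fun p : I × I × X => ipow p.2.1 p.1) (s, t, x) :=
      (continuousAt_ipow ht s).comp (x := (s, t, x))
        (f := fun p : I × I × X => (p.2.1, p.1)) (by fun_prop)
    have hx : ContinuousAt (fun p : I × I × X => p.2.2) (s, t, x) := by fun_prop
    exact hF.continuousAt.comp (x := (s, t, x)) (hu.prodMk (hv.prodMk hx))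

/-- Let `X, Y, Z` be topological abelian groups and
`α : I × Y → Z`, `β : I × X → Y` continuous maps with `α(0,·) = 0`,
`β(0,·) = 0` and each `α(t,·)`, `β(t,·)` a homomorphism.  Then
`Φ(s,t,x) = α(t^(1−s), β(t^s, x))` is continuous, each `Φ(s,t,·)` is a
homomorphism, and `Φ(0,t,x) = α(t, β(1,x))`, `Φ(1,t,x) = α(1, β(t,x))`,
`Φ(s,0,x) = 0`, `Φ(s,1,x) = α(1, β(1,x))`.  Consequently, in the 2-cell
structure on topological abelian groups given by homotopy classes `[α]` with
`D([α]) = α(1,·)`, one has `[α]·D([β]) = D([α])·[β]`, i.e. `D(x)y = xD(y)`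
holds for all 2-cells. -/
theorem tag_naturality
    {X Y Z : Type*} [AddCommGroup X] [AddCommGroup Y] [AddCommGroup Z]
    [TopologicalSpace X] [TopologicalSpace Y] [TopologicalSpace Z]
    (α : unitInterval → Y → Z) (β : unitInterval → X → Y)
    (hαc : Continuous (fun p : unitInterval × Y => α p.1 p.2))
    (hβc : Continuous (fun p : unitInterval × X => β p.1 p.2))
    (hα0 : ∀ y, α 0 y = 0) (hβ0 : ∀ x, β 0 x = 0)
    (hαhom : ∀ t (y y' : Y), α t (y + y') = α t y + α t y')
    (hβhom : ∀ t (x x' : X), β t (x + x') = β t x + β t x') :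
    Continuous (fun p : unitInterval × unitInterval × X =>
        α (ipow p.2.1 (unitInterval.symm p.1)) (β (ipow p.2.1 p.1) p.2.2)) ∧
    (∀ s t (x x' : X),
        α (ipow t (unitInterval.symm s)) (β (ipow t s) (x + x'))
          = α (ipow t (unitInterval.symm s)) (β (ipow t s) x)
            + α (ipow t (unitInterval.symm s)) (β (ipow t s) x')) ∧
    (∀ t x, α (ipow t (unitInterval.symm 0)) (β (ipow t 0) x) = α t (β 1 x)) ∧
    (∀ t x, α (ipow t (unitInterval.symm 1)) (β (ipow t 1) x) = α 1 (β t x)) ∧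
    (∀ s x, α (ipow 0 (unitInterval.symm s)) (β (ipow 0 s) x) = 0) ∧
    (∀ s x, α (ipow 1 (unitInterval.symm s)) (β (ipow 1 s) x) = α 1 (β 1 x)) ∧
    HtpyRel (fun t x => α t (β 1 x)) (fun t x => α 1 (β t x)) := by
  have hα_zero (u : I) : α u 0 = 0 := by simpa using hαhom u 0 0
  have hvanish (u v : I) (x : X) (huv : u * v = 0) : α u (β v x) = 0 := by
    rcases mul_eq_zero.1 huv with rfl | rfl
    · exact hα0 _
    · rw [hβ0, hα_zero]
  have hF : Continuous fun p : I × I × X => α p.1 (β p.2.1 p.2.2) :=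
    hαc.comp (continuous_fst.prodMk (hβc.comp continuous_snd))
  have hcont := continuous_comp_ipow (F := fun u v x => α u (β v x)) hF hvanish
  have hhom (s t : I) (x x' : X) : α (ipow t (σ s)) (β (ipow t s) (x + x'))
      = α (ipow t (σ s)) (β (ipow t s) x) + α (ipow t (σ s)) (β (ipow t s) x') := by
    rw [hβhom, hαhom]
  have hs0 (t : I) (x : X) : α (ipow t (σ 0)) (β (ipow t 0) x) = α t (β 1 x) := by
    rw [symm_zero, ipow_one_right, ipow_zero_right]
  have hs1 (t : I) (x : X) : α (ipow t (σ 1)) (β (ipow t 1) x) = α 1 (β t x) := by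
    rw [symm_one, ipow_one_right, ipow_zero_right]
  have ht0 (s : I) (x : X) : α (ipow 0 (σ s)) (β (ipow 0 s) x) = 0 :=
    hvanish _ _ _ (ipow_symm_mul_ipow 0 s)
  have ht1 (s : I) (x : X) : α (ipow 1 (σ s)) (β (ipow 1 s) x) = α 1 (β 1 x) := by
    rw [ipow_one_left, ipow_one_left]
  exact ⟨hcont, hhom, hs0, hs1, ht0, ht1, rfl,
    fun s t x => α (ipow t (σ s)) (β (ipow t s) x), hcont,
    funext₂ hs0, funext₂ hs1, fun s => funext (ht0 s), fun s => funext (ht1 s), hhom⟩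
end
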